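/- arXiv:1708.07286 — 2 statements merged into one kernel-verified Lean document; each statement's English description precedes it below -/
import Mathlib

section
/- Suppose G is connected and balanced with partition V = V₁ ∪ V₂ as in the Cartwright–Harary theorem, and x ∈ ℝⁿ. Define x̃ by x̃ᵢ = |xᵢ| if i ∈ V₁ and x̃ᵢ = -|xᵢ| if i ∈ V₂. Then for all i, j, γᵢⱼ x̃ᵢ x̃ⱼ ≥ 0, and consequently E(x̃) ≤ E(x) for every κ ≥ 0. -/
/-- for a balanced partition (`σ i = true` meaning `i ∈ V₁`), the
sign-adjusted vector `x̃` (`x̃ᵢ = |xᵢ|` on `V₁`, `x̃ᵢ = -|xᵢ|` on `V₂`) satisfies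
`γᵢⱼ x̃ᵢ x̃ⱼ ≥ 0` for all `i, j`, and hence `E(x̃) ≤ E(x)` for every `κ ≥ 0`. -/
theorem stmt6 (n : ℕ) (γ : Fin n → Fin n → ℝ)
    (hsym : ∀ i j, γ i j = γ j i)
    (σ : Fin n → Bool)
    (hpart : ∀ i j, (σ i = σ j → 0 ≤ γ i j) ∧ (σ i ≠ σ j → γ i j ≤ 0))
    (W : ℝ → ℝ) (heven : ∀ t, W (-t) = W t)
    (κ : ℝ) (hκ : 0 ≤ κ)
    (E : (Fin n → ℝ) → ℝ)
    (hE : ∀ x, E x = ∑ i, W (x i) + κ / 2 * ∑ i, ∑ j, γ i j * (x i - x j) ^ 2)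
    (x : Fin n → ℝ) (xt : Fin n → ℝ)
    (hxt : ∀ i, xt i = if σ i then |x i| else -|x i|) :
    (∀ i j, 0 ≤ γ i j * xt i * xt j) ∧ E xt ≤ E x := by
  have key : ∀ i j, γ i j * xt i * xt j = |γ i j * x i * x j| := by
    intro i j
    rw [abs_mul, abs_mul, hxt i, hxt j]
    obtain ⟨h1, h2⟩ := hpart i j
    cases hi : σ i <;> cases hj : σ j <;> simp only [hi, hj] at h1 h2
    · rw [abs_of_nonneg (h1 trivial)]; simp
    · rw [abs_of_nonpos (h2 (by simp))]; simp
    · rw [abs_of_nonpos (h2 (by simp))]; simp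
    · rw [abs_of_nonneg (h1 trivial)]; simp
  have hsq : ∀ i, xt i ^ 2 = x i ^ 2 := by
    intro i
    rw [hxt i]
    split_ifs <;> simp
  have hW : ∀ i, W (xt i) = W (x i) := by
    intro i
    have habs : W |x i| = W (x i) := by
      rcases abs_choice (x i) with h | h <;> rw [h]
      exact heven _
    rw [hxt i]
    split_ifs
    · exact habs
    · rw [heven, habs]
  refine ⟨fun i j => by rw [key]; exact abs_nonneg _, ?_⟩
  rw [hE, hE, Finset.sum_congr rfl fun i _ => hW i]
  gcongr _ + κ / 2 * ?_
  refine Finset.sum_le_sum fun i _ => Finset.sum_le_sum fun j _ => ?_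
  have h1 := le_abs_self (γ i j * x i * x j)
  rw [← key] at h1
  have e1 : γ i j * (xt i - xt j) ^ 2
      = γ i j * (xt i ^ 2 + xt j ^ 2) - 2 * (γ i j * xt i * xt j) := by ring
  rw [e1, hsq, hsq]
  linarith [show γ i j * (x i - x j) ^ 2
      = γ i j * (x i ^ 2 + x j ^ 2) - 2 * (γ i j * x i * x j) by ring]
end

section
/- For every s ≥ 0 there exists a potential W ∈ 𝒲 (with 2s+1 inflection points on (0,m)) such that for every connected weighted graph G with ‖L(G)‖ > 0 there exists κ > 0 with m(W,G,κ) ≥ m(W,G,0) + 2s, where m(W,G,κ) denotes the number of local minima of E_{W,G,κ}. In particular C(W) = inf_G sup_{κ≥0} (m(W,G,κ) - m(W,G,0)) ≥ 2s. -/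
/-- nodes -/
noncomputable def nodeL (s : ℕ) (j : ℕ) : ℝ := 7 / 8 + (j : ℝ) / (16 * ((s : ℝ) + 1))

/-- prescribed values -/
noncomputable def nodeW (j : ℕ) : ℝ := if Even j then -2 else -1 / 2

lemma nodeL_strictMono (s : ℕ) : StrictMono (nodeL s) := by
  intro i j h
  unfold nodeL
  have : (i : ℝ) < j := by exact_mod_cast h
  gcongr

lemma nodeL_zero (s : ℕ) : nodeL s 0 = 7 / 8 := by simp [nodeL]

lemma nodeL_ge (s j : ℕ) : 7 / 8 ≤ nodeL s j := by
  unfold nodeL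
  have : 0 ≤ (j : ℝ) / (16 * ((s : ℝ) + 1)) := by positivity
  linarith

lemma nodeL_lt (s j : ℕ) (h : j < 2 * s + 2) : nodeL s j < 1 := by
  unfold nodeL
  have h' : (j : ℝ) < 2 * s + 2 := by exact_mod_cast h
  have : (j : ℝ) / (16 * ((s : ℝ) + 1)) < 1 / 8 := by
    rw [div_lt_div_iff₀ (by positivity) (by norm_num)]
    linarith
  linarith

lemma exists_Q (s : ℕ) : ∃ Q : Polynomial ℝ, ∀ j < 2 * s + 2,
    (nodeL s j) * ((nodeL s j) ^ 2 - 1) * ((Q.eval ((nodeL s j) ^ 2)) ^ 2 + 1) = nodeW j ∧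
    (2 - nodeL s j) * ((2 - nodeL s j) ^ 2 - 1) * ((Q.eval ((2 - nodeL s j) ^ 2)) ^ 2 + 1)
      = - nodeW j := by
  classical
  let S : Finset (ℕ × Bool) := Finset.range (2 * s + 2) ×ˢ Finset.univ
  let t : ℕ × Bool → ℝ := fun p => if p.2 then nodeL s p.1 else 2 - nodeL s p.1
  let w : ℕ × Bool → ℝ := fun p => if p.2 then nodeW p.1 else - nodeW p.1
  let r : ℕ × Bool → ℝ := fun p => Real.sqrt (w p / (t p * ((t p) ^ 2 - 1)) - 1)
  have hinj : Set.InjOn (fun p => (t p) ^ 2) (S : Set (ℕ × Bool)) := by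
    rintro ⟨i, b⟩ hi ⟨j, c⟩ hj h
    simp only [S, Finset.coe_product, Set.mem_prod, Finset.coe_range, Set.mem_Iio] at hi hj
    have h1 := nodeL_ge s i
    have h2 := nodeL_ge s j
    have h3 := nodeL_lt s i hi.1
    have h4 := nodeL_lt s j hj.1
    have ht : t (i, b) = t (j, c) := by
      have e1 : 0 ≤ t (i, b) := by simp only [t]; split_ifs <;> linarith
      have e2 : 0 ≤ t (j, c) := by simp only [t]; split_ifs <;> linarith
      exact (sq_eq_sq₀ e1 e2).1 h
    cases b <;> cases c <;> simp [t] at ht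
    · simpa using (nodeL_strictMono s).injective ht
    · linarith
    · linarith
    · simpa using (nodeL_strictMono s).injective ht
  refine ⟨Lagrange.interpolate S (fun p => (t p) ^ 2) r, ?_⟩
  have key : ∀ p ∈ S, t p * ((t p) ^ 2 - 1) *
      (((Lagrange.interpolate S (fun p => (t p) ^ 2) r).eval ((t p) ^ 2)) ^ 2 + 1) = w p := by
    rintro ⟨j, b⟩ hp
    have := Lagrange.eval_interpolate_at_node r hinj hp
    rw [this]
    simp only [S, Finset.mem_product, Finset.mem_range] at hp
    have h1 := nodeL_ge s j
    have h3 := nodeL_lt s j hp.1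
    have hw : nodeW j ≤ -1 / 2 := by unfold nodeW; split_ifs <;> norm_num
    have main : t (j, b) * (t (j, b) ^ 2 - 1) ≠ 0 ∧
        1 ≤ w (j, b) / (t (j, b) * (t (j, b) ^ 2 - 1)) := by
      cases b
      · simp only [t, w]
        simp only [Bool.false_eq_true, if_false]
        set y := 1 - nodeL s j with hy
        have e : (2 - nodeL s j) * ((2 - nodeL s j) ^ 2 - 1) = (1 + y) * (y * (2 + y)) := by
          rw [hy]; ring
        have hy0 : 0 < y := by linarith
        have hy1 : y ≤ 1 / 8 := by linarith
        have hpos : 0 < (1 + y) * (y * (2 + y)) := by positivity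
        rw [e]
        refine ⟨hpos.ne', ?_⟩
        rw [le_div_iff₀ hpos]
        have : (1 + y) * (y * (2 + y)) ≤ (1 + 1/8) * (1/8 * (2 + 1/8)) := by gcongr
        linarith
      · simp only [t, w]
        simp only [if_true]
        set y := 1 - nodeL s j with hy
        have e : nodeL s j * (nodeL s j ^ 2 - 1) = -((1 - y) * (y * (2 - y))) := by
          rw [hy]; ring
        have hy0 : 0 < y := by linarith
        have hy1 : y ≤ 1 / 8 := by linarith
        have hpos : 0 < (1 - y) * (y * (2 - y)) := by
          have : 0 < 1 - y := by linarith
          have : 0 < 2 - y := by linarith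
          positivity
        rw [e]
        refine ⟨(neg_neg_of_pos hpos).ne, ?_⟩
        rw [le_div_iff_of_neg (neg_neg_of_pos hpos)]
        have : (1 - y) * (y * (2 - y)) ≤ (1) * (1/8 * (2)) := by
          have hA : 0 ≤ y * (2 - y) := mul_nonneg hy0.le (by linarith)
          gcongr <;> linarith
        linarith
    rw [Real.sq_sqrt (by linarith [main.2])]
    rw [sub_add_cancel, mul_div_cancel₀ _ main.1]
  intro j hj
  have k1 := key (j, true) (by simp [S, hj])
  have k2 := key (j, false) (by simp [S, hj])
  simp only [t, w] at k1 k2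
  simp only [Bool.false_eq_true, if_false, if_true] at k1 k2
  exact ⟨k1, k2⟩

lemma exists_D (s : ℕ) : ∃ (D : Polynomial ℝ) (P : ℝ → ℝ), 1 < D.natDegree ∧
    (∀ t, D.eval t = t * (t ^ 2 - 1) * (P t + 1)) ∧ (∀ t, P (-t) = P t) ∧ (∀ t, 0 ≤ P t) ∧
    ∀ j < 2 * s + 2, D.eval (nodeL s j) = nodeW j ∧ D.eval (2 - nodeL s j) = - nodeW j := by
  obtain ⟨Q, hQ⟩ := exists_Q s
  have hev : ∀ t, ((Polynomial.X ^ 3 - Polynomial.X) * ((Q.comp (Polynomial.X ^ 2)) ^ 2 + 1) :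
      Polynomial ℝ).eval t = t * (t ^ 2 - 1) * ((Q.eval (t ^ 2)) ^ 2 + 1) := by
    intro t
    simp [Polynomial.eval_comp]
    left; ring
  refine ⟨(Polynomial.X ^ 3 - Polynomial.X) * ((Q.comp (Polynomial.X ^ 2)) ^ 2 + 1),
    fun t => (Q.eval (t ^ 2)) ^ 2, ?_, hev, ?_, ?_, ?_⟩
  · have h3 : (Polynomial.X ^ 3 - Polynomial.X : Polynomial ℝ).natDegree = 3 := by
      compute_degree!
    have hne : ((Q.comp (Polynomial.X ^ 2)) ^ 2 + 1 : Polynomial ℝ) ≠ 0 := by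
      intro h
      have := congrArg (Polynomial.eval 0) h
      simp at this
      nlinarith [sq_nonneg (Polynomial.eval 0 (Q.comp (Polynomial.X ^ 2)))]
    rw [Polynomial.natDegree_mul (by intro h; rw [h] at h3; simp at h3) hne, h3]
    omega
  · intro t; simp
  · intro t; positivity
  · intro j hj
    rw [hev, hev]
    exact hQ j hj

/-- finiteness -/
lemma finite_crit {n : ℕ} (d : ℕ) (hd : 1 < d) (a : ℕ → ℝ) (c : Fin n → Fin n → ℝ)
    (Z : Set (Fin n → ℝ))
    (hZ : ∀ z ∈ Z, ∀ i, z i ^ d = ∑ k ∈ Finset.range d, a k * z i ^ k + ∑ j, c i j * z j) :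
    Z.Finite := by
  classical
  let mon : (Fin n → ℕ) → (Z → ℝ) := fun α z => ∏ i, (z.1 i) ^ (α i)
  let G : Set (Z → ℝ) := mon '' (Fintype.piFinset (fun _ : Fin n => Finset.range d) : Finset _)
  have hG : G.Finite := Set.Finite.image _ (Finset.finite_toSet _)
  let B := Submodule.span ℝ G
  have hadd : ∀ (β : Fin n → ℕ) (i : Fin n) (k : ℕ) (z : Z),
      mon (β + Pi.single i k) z = mon β z * z.1 i ^ k := by
    intro β i k z
    simp only [mon, Pi.add_apply, pow_add, Finset.prod_mul_distrib]
    congr 1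
    rw [Finset.prod_eq_single i]
    · simp
    · intro j _ hj; simp [Pi.single_eq_of_ne hj]
    · simp
  have hsum : ∀ (β : Fin n → ℕ) (i : Fin n) (k : ℕ),
      ∑ x, (β + Pi.single i k : Fin n → ℕ) x = ∑ x, β x + k := by
    intro β i k
    simp [Finset.sum_add_distrib]
  have hB : ∀ (N : ℕ) (α : Fin n → ℕ), ∑ i, α i = N → mon α ∈ B := by
    intro N
    induction N using Nat.strong_induction_on with
    | _ N ih =>
      intro α hα
      by_cases hlt : ∀ i, α i < d
      · apply Submodule.subset_span
        refine ⟨α, ?_, rfl⟩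
        simpa using hlt
      · push Not at hlt
        obtain ⟨i, hi⟩ := hlt
        obtain ⟨β, rfl⟩ : ∃ β : Fin n → ℕ, α = β + (Pi.single i d : Fin n → ℕ) := by
          refine ⟨α - Pi.single i d, ?_⟩
          funext j
          by_cases hj : j = i
          · subst hj; simp [Pi.add_apply]; omega
          · simp [Pi.single_eq_of_ne hj]
        rw [hsum] at hα
        have e : mon (β + Pi.single i d) =
            ∑ k ∈ Finset.range d, a k • mon (β + Pi.single i k)
              + ∑ j, c i j • mon (β + Pi.single j 1) := by
          funext z
          simp only [Pi.add_apply, Finset.sum_apply, Pi.smul_apply, hadd, smul_eq_mul]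
          rw [hZ z.1 z.2 i, mul_add, Finset.mul_sum, Finset.mul_sum]
          congr 1
          · exact Finset.sum_congr rfl fun _ _ => by ring
          · exact Finset.sum_congr rfl fun _ _ => by ring
        rw [e]
        apply Submodule.add_mem
        · refine Submodule.sum_mem _ fun k hk => Submodule.smul_mem _ _ ?_
          refine ih _ ?_ _ (hsum β i k)
          have := Finset.mem_range.1 hk
          omega
        · refine Submodule.sum_mem _ fun j _ => Submodule.smul_mem _ _ ?_
          refine ih _ ?_ _ (hsum β j 1)
          omega
  have hcoord : ∀ i, ∃ p : Polynomial ℝ, p ≠ 0 ∧ ∀ z : Z, p.eval (z.1 i) = 0 := by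
    intro i
    let f : Polynomial ℝ →ₗ[ℝ] (Z → ℝ) := LinearMap.pi fun z => Polynomial.leval (z.1 i)
    have hf : ∀ p, f p ∈ B := by
      intro p
      have : f p = ∑ k ∈ Finset.range (p.natDegree + 1), p.coeff k • mon (0 + Pi.single i k) := by
        funext z
        simp only [Finset.sum_apply, Pi.smul_apply, hadd]
        simp [f, mon, Polynomial.eval_eq_sum_range]
      rw [this]
      exact Submodule.sum_mem _ fun k _ => Submodule.smul_mem _ _ (hB _ _ rfl)
    by_contra hcon
    push Not at hcon
    let g : Polynomial ℝ →ₗ[ℝ] B := f.codRestrict B hf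
    have hg : Function.Injective g := by
      rw [injective_iff_map_eq_zero]
      intro p hp
      by_contra hne
      obtain ⟨z, hz⟩ := hcon p hne
      apply hz
      have := congrArg (fun q : B => (q : Z → ℝ) z) hp
      simpa [g, f] using this
    have : Module.Finite ℝ B := Module.Finite.span_of_finite ℝ hG
    exact Polynomial.not_finite (Module.Finite.of_injective g hg)
  choose p hp0 hp using hcoord
  refine Set.Finite.subset (Set.Finite.pi' (t := fun i => {x | (p i).eval x = 0}) ?_) ?_
  · intro i
    exact (Polynomial.finite_setOfPred_isRoot (hp0 i))
  · intro z hz i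
    exact hp i ⟨z, hz⟩

/-- energy -/
noncomputable def energy {n : ℕ} (W : ℝ → ℝ) (γ : Fin n → Fin n → ℝ) (κ : ℝ) (y : Fin n → ℝ) : ℝ :=
  ∑ i, W (y i) + κ / 2 * ∑ i, ∑ j, γ i j * (y i - y j) ^ 2

/-- force -/
noncomputable def force {n : ℕ} (γ : Fin n → Fin n → ℝ) (κ : ℝ) (y : Fin n → ℝ) (i : Fin n) : ℝ :=
  2 * κ * ∑ j, γ i j * (y i - y j)

lemma hasDerivAt_energy {n : ℕ} {W D : ℝ → ℝ} (hW : ∀ t, HasDerivAt W (D t) t)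
    {γ : Fin n → Fin n → ℝ} (hγ : ∀ i j, γ i j = γ j i) (κ : ℝ) (x : Fin n → ℝ) (i : Fin n) :
    HasDerivAt (fun t => energy W γ κ (Function.update x i t)) (D (x i) + force γ κ x i) (x i) := by
  have hu : ∀ j, HasDerivAt (fun t => Function.update x i t j) ((Pi.single i (1 : ℝ) : Fin n → ℝ) j)
      (x i) := hasDerivAt_pi.1 (hasDerivAt_update x i (x i))
  have hx : ∀ j, Function.update x i (x i) j = x j := by simp
  have h1 : HasDerivAt (fun t => ∑ j, W (Function.update x i t j))
      (∑ j, D (x j) * (Pi.single i (1 : ℝ) : Fin n → ℝ) j) (x i) := by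
    refine HasDerivAt.fun_sum fun j _ => ?_
    have := HasDerivAt.comp (x i) (hW (Function.update x i (x i) j)) (hu j)
    rw [hx] at this
    exact this
  have h2 : HasDerivAt (fun t => ∑ a, ∑ b, γ a b *
        (Function.update x i t a - Function.update x i t b) ^ 2)
      (∑ a, ∑ b, γ a b * (2 * (x a - x b) * ((Pi.single i (1 : ℝ) : Fin n → ℝ) a
        - (Pi.single i (1 : ℝ) : Fin n → ℝ) b))) (x i) := by
    refine HasDerivAt.fun_sum fun a _ => HasDerivAt.fun_sum fun b _ => ?_
    have := (((hu a).fun_sub (hu b)).fun_pow 2).const_mul (γ a b)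
    refine this.congr_deriv ?_
    simp [hx]
  have h3 := h1.add (h2.const_mul (κ / 2))
  refine HasDerivAt.congr_deriv h3 ?_
  symm
  have e0 : ∑ j, D (x j) * (Pi.single i (1 : ℝ) : Fin n → ℝ) j = D (x i) := by
    simp [Pi.single_apply]
  have e1 : ∑ a, ∑ b, γ a b * (2 * (x a - x b)) * (Pi.single i (1 : ℝ) : Fin n → ℝ) a
      = 2 * ∑ b, γ i b * (x i - x b) := by
    rw [Finset.sum_comm, Finset.mul_sum]
    refine Finset.sum_congr rfl fun b _ => ?_
    simp [Pi.single_apply]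
    ring
  have e2 : ∑ a, ∑ b, γ a b * (2 * (x a - x b)) * (Pi.single i (1 : ℝ) : Fin n → ℝ) b
      = - (2 * ∑ b, γ i b * (x i - x b)) := by
    rw [Finset.mul_sum, ← Finset.sum_neg_distrib]
    refine Finset.sum_congr rfl fun b _ => ?_
    simp [Pi.single_apply]
    rw [hγ b i]
    ring
  have e3 : ∑ a, ∑ b, γ a b * (2 * (x a - x b) * ((Pi.single i (1 : ℝ) : Fin n → ℝ) a
        - (Pi.single i (1 : ℝ) : Fin n → ℝ) b)) = 2 * (2 * ∑ b, γ i b * (x i - x b)) := by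
    have : ∀ a b, γ a b * (2 * (x a - x b) * ((Pi.single i (1 : ℝ) : Fin n → ℝ) a
        - (Pi.single i (1 : ℝ) : Fin n → ℝ) b)) =
        γ a b * (2 * (x a - x b)) * (Pi.single i (1 : ℝ) : Fin n → ℝ) a -
        γ a b * (2 * (x a - x b)) * (Pi.single i (1 : ℝ) : Fin n → ℝ) b := by
      intro a b; ring
    simp only [this, Finset.sum_sub_distrib]
    rw [e1, e2]; ring
  rw [e0, e3]
  unfold force
  ring

lemma crit_of_localMin {n : ℕ} {W D : ℝ → ℝ} (hW : ∀ t, HasDerivAt W (D t) t)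
    {γ : Fin n → Fin n → ℝ} (hγ : ∀ i j, γ i j = γ j i) (κ : ℝ) (x : Fin n → ℝ)
    (hx : IsLocalMin (energy W γ κ) x) (i : Fin n) : D (x i) + force γ κ x i = 0 := by
  have h := hasDerivAt_energy hW hγ κ x i
  have hc : ContinuousAt (fun t => Function.update x i t) (x i) := by fun_prop
  have : IsLocalMin (fun t => energy W γ κ (Function.update x i t)) (x i) := by
    have h2 : IsLocalMin (energy W γ κ) (Function.update x i (x i)) := by simpa using hx
    exact IsLocalMin.comp_continuous (g := fun t => Function.update x i t) h2 hc
  exact this.hasDerivAt_eq_zero h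

lemma box_lemma {n : ℕ} {W D : ℝ → ℝ} (hW : ∀ t, HasDerivAt W (D t) t)
    {γ : Fin n → Fin n → ℝ} (hγ : ∀ i j, γ i j = γ j i) (κ : ℝ) (lo hi : Fin n → ℝ)
    (hlt : ∀ i, lo i < hi i)
    (hlo : ∀ x ∈ Set.Icc lo hi, ∀ i, D (lo i) + force γ κ x i < 0)
    (hhi : ∀ x ∈ Set.Icc lo hi, ∀ i, 0 < D (hi i) + force γ κ x i) :
    ∃ x, IsLocalMin (energy W γ κ) x ∧ ∀ i, lo i < x i ∧ x i < hi i := by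
  have hWc : Continuous W := continuous_iff_continuousAt.2 fun t => (hW t).continuousAt
  have hc : Continuous (energy W γ κ) := by unfold energy; fun_prop
  obtain ⟨x, hxm, hx⟩ := (isCompact_Icc (a := lo) (b := hi)).exists_isMinOn
    ⟨lo, Set.left_mem_Icc.2 fun i => (hlt i).le⟩ hc.continuousOn
  have hmem : ∀ i t, lo i ≤ t → t ≤ hi i → Function.update x i t ∈ Set.Icc lo hi := by
    intro i t h1 h2
    constructor
    · intro j
      by_cases hj : j = i
      · subst hj; simpa using h1
      · simpa [Function.update_of_ne hj] using hxm.1 j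
    · intro j
      by_cases hj : j = i
      · subst hj; simpa using h2
      · simpa [Function.update_of_ne hj] using hxm.2 j
  have hle : ∀ i t, lo i ≤ t → t ≤ hi i →
      energy W γ κ (Function.update x i (x i)) ≤ energy W γ κ (Function.update x i t) := by
    intro i t h1 h2
    rw [Function.update_eq_self]
    exact hx (hmem i t h1 h2)
  have hstrict : ∀ i, lo i < x i ∧ x i < hi i := by
    intro i
    have hd := hasDerivAt_energy hW hγ κ x i
    constructor
    · refine lt_of_le_of_ne (hxm.1 i) fun heq => ?_
      have hneg := hlo x hxm i
      rw [heq] at hneg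
      have h1 : ∀ᶠ t in nhdsWithin (x i) (Set.Ioi (x i)), slope
          (fun t => energy W γ κ (Function.update x i t)) (x i) t < 0 :=
        ((hasDerivAt_iff_tendsto_slope.1 hd).mono_left
          (nhdsWithin_mono _ fun t ht => (ne_of_gt ht))).eventually (gt_mem_nhds hneg)
      have h2 : ∀ᶠ t in nhdsWithin (x i) (Set.Ioi (x i)), t ∈ Set.Ioo (x i) (hi i) :=
        Ioo_mem_nhdsGT (heq ▸ hlt i)
      obtain ⟨t, ht1, ht2⟩ := (h1.and h2).exists
      have := hle i t (heq ▸ ht2.1.le) ht2.2.le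
      rw [slope_def_field] at ht1
      have : 0 ≤ (energy W γ κ (Function.update x i t) -
        energy W γ κ (Function.update x i (x i))) / (t - x i) :=
        div_nonneg (by linarith) (by linarith [ht2.1])
      linarith
    · refine lt_of_le_of_ne (hxm.2 i) fun heq => ?_
      have hpos := hhi x hxm i
      rw [← heq] at hpos
      have h1 : ∀ᶠ t in nhdsWithin (x i) (Set.Iio (x i)), 0 < slope
          (fun t => energy W γ κ (Function.update x i t)) (x i) t :=
        ((hasDerivAt_iff_tendsto_slope.1 hd).mono_left
          (nhdsWithin_mono _ fun t ht => (ne_of_lt ht))).eventually (lt_mem_nhds hpos)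
      have h2 : ∀ᶠ t in nhdsWithin (x i) (Set.Iio (x i)), t ∈ Set.Ioo (lo i) (x i) :=
        Ioo_mem_nhdsLT (heq ▸ hlt i)
      obtain ⟨t, ht1, ht2⟩ := (h1.and h2).exists
      have := hle i t ht2.1.le (heq ▸ ht2.2.le)
      rw [slope_def_field] at ht1
      have : (energy W γ κ (Function.update x i t) -
        energy W γ κ (Function.update x i (x i))) / (t - x i) ≤ 0 :=
        div_nonpos_of_nonneg_of_nonpos (by linarith) (by linarith [ht2.2])
      linarith
  refine ⟨x, ?_, hstrict⟩
  refine hx.isLocalMin ?_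
  rw [← Set.pi_univ_Icc]
  exact set_pi_mem_nhds Set.finite_univ fun i _ => Icc_mem_nhds (hstrict i).1 (hstrict i).2

lemma finite_localMin {n : ℕ} {W : ℝ → ℝ} (D : Polynomial ℝ) (hD : 1 < D.natDegree)
    (hW : ∀ t, HasDerivAt W (D.eval t) t)
    {γ : Fin n → Fin n → ℝ} (hγ : ∀ i j, γ i j = γ j i) (κ : ℝ) :
    {x | IsLocalMin (energy W γ κ) x}.Finite := by
  have hl : D.leadingCoeff ≠ 0 := by
    intro h
    rw [Polynomial.leadingCoeff_eq_zero] at h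
    simp [h] at hD
  refine finite_crit D.natDegree hD (fun k => - D.coeff k / D.leadingCoeff)
    (fun i j => - (2 * κ * ((if j = i then ∑ k, γ i k else 0) - γ i j)) / D.leadingCoeff) _ ?_
  intro z hz i
  have h := crit_of_localMin hW hγ κ z hz i
  rw [Polynomial.eval_eq_sum_range, Finset.sum_range_succ] at h
  have hf : force γ κ z i = ∑ j, (2 * κ * ((if j = i then ∑ k, γ i k else 0) - γ i j)) * z j := by
    unfold force
    simp only [mul_assoc, ← Finset.mul_sum, sub_mul, ite_mul, zero_mul, Finset.sum_sub_distrib,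
      Finset.sum_ite_eq', Finset.mem_univ, if_true, mul_sub, Finset.sum_mul]
  rw [hf] at h
  have e1 : ∑ k ∈ Finset.range D.natDegree, - D.coeff k / D.leadingCoeff * z i ^ k =
      (- ∑ k ∈ Finset.range D.natDegree, D.coeff k * z i ^ k) / D.leadingCoeff := by
    rw [← Finset.sum_neg_distrib, Finset.sum_div]
    exact Finset.sum_congr rfl fun _ _ => by ring
  have e2 : ∑ j, - (2 * κ * ((if j = i then ∑ k, γ i k else 0) - γ i j)) / D.leadingCoeff * z j =
      (- ∑ j, (2 * κ * ((if j = i then ∑ k, γ i k else 0) - γ i j)) * z j) / D.leadingCoeff := by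
    rw [← Finset.sum_neg_distrib, Finset.sum_div]
    exact Finset.sum_congr rfl fun _ _ => by ring
  rw [e1, e2, ← add_div, eq_div_iff hl]
  change _ * D.coeff D.natDegree = _
  linarith

lemma inflections (s : ℕ) (D : Polynomial ℝ) (h0 : D.eval 0 = 0)
    (hn : ∀ j < 2 * s + 2, D.eval (nodeL s j) = nodeW j) :
    ∃ I : Finset ℝ, I.card = 2 * s + 1 ∧
      ∀ t ∈ I, t ∈ Set.Ioo (0 : ℝ) 1 ∧ deriv (fun x => D.eval x) t = 0 := by
  classical
  let x : ℕ → ℝ := fun j => if j = 0 then 0 else nodeL s (j - 1)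
  have hx0 : x 0 = 0 := by simp [x]
  have hxs : ∀ j, x (j + 1) = nodeL s j := by intro j; simp [x]
  have hxm : StrictMono x := by
    apply strictMono_nat_of_lt_succ
    intro j
    cases j with
    | zero => rw [hx0, hxs]; linarith [nodeL_ge s 0]
    | succ k => rw [hxs, hxs]; exact nodeL_strictMono s (Nat.lt_succ_self k)
  have hc : ∀ S, ContinuousOn (fun t => D.eval t) S := fun S => D.continuous.continuousOn
  have hy : ∀ j, ∃ y, j < 2 * s + 2 → (x j < y ∧ y < x (j + 1) ∧ D.eval y = -1) := by
    intro j
    by_cases hj : j < 2 * s + 2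
    · have hle : x j ≤ x (j + 1) := (hxm (Nat.lt_succ_self j)).le
      have h2 := hn j hj
      rw [← hxs] at h2
      by_cases he : Even j
      · have h3 : -1 < D.eval (x j) := by
          cases j with
          | zero => rw [hx0, h0]; norm_num
          | succ k =>
            have hk : ¬ Even k := by
              intro h; exact (Nat.even_add_one.1 he) h
            rw [hxs, hn k (by omega)]
            simp [nodeW, hk]; norm_num
        have h4 : D.eval (x (j + 1)) < -1 := by rw [h2]; simp [nodeW, he]; 
        obtain ⟨y, hy, hy'⟩ := intermediate_value_Ioo' hle (hc _) ⟨h4, h3⟩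
        exact ⟨y, fun _ => ⟨hy.1, hy.2, hy'⟩⟩
      · have h3 : D.eval (x j) < -1 := by
          cases j with
          | zero => simp at he
          | succ k =>
            have hk : Even k := by
              by_contra h; exact he (Nat.even_add_one.2 h)
            rw [hxs, hn k (by omega)]
            simp [nodeW, hk]
        have h4 : -1 < D.eval (x (j + 1)) := by rw [h2]; simp [nodeW, he]; norm_num
        obtain ⟨y, hy, hy'⟩ := intermediate_value_Ioo hle (hc _) ⟨h3, h4⟩
        exact ⟨y, fun _ => ⟨hy.1, hy.2, hy'⟩⟩
    · exact ⟨0, fun h => absurd h hj⟩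
  choose y hy using hy
  have hz : ∀ j, ∃ z, j < 2 * s + 1 → (y j < z ∧ z < y (j + 1) ∧
      deriv (fun x => D.eval x) z = 0) := by
    intro j
    by_cases hj : j < 2 * s + 1
    · have a1 := hy j (by omega)
      have a2 := hy (j + 1) (by omega)
      obtain ⟨z, hz, hz'⟩ := exists_deriv_eq_zero (f := fun x => D.eval x) (a := y j)
        (b := y (j + 1)) (by linarith) (hc _) (by simp only [a1.2.2, a2.2.2])
      exact ⟨z, fun _ => ⟨hz.1, hz.2, hz'⟩⟩
    · exact ⟨0, fun h => absurd h hj⟩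
  choose z hz using hz
  have hzlt : ∀ i j, i < j → j < 2 * s + 1 → z i < z j := by
    intro i j hij hj
    have a1 := hz i (by omega)
    have a2 := hz j hj
    have : y (i + 1) ≤ y j := by
      rcases Nat.eq_or_lt_of_le (Nat.succ_le_of_lt hij) with h | h
      · exact le_of_eq (congrArg y h)
      · have b1 := hy (i + 1) (by omega)
        have b2 := hy j (by omega)
        have b3 : x (i + 1 + 1) ≤ x j := hxm.monotone h
        linarith
    linarith
  refine ⟨(Finset.range (2 * s + 1)).image z, ?_, ?_⟩
  · rw [Finset.card_image_of_injOn, Finset.card_range]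
    intro i hi j hj hij
    simp only [Finset.coe_range, Set.mem_Iio] at hi hj
    rcases lt_trichotomy i j with h | h | h
    · exact absurd hij (hzlt i j h hj).ne
    · exact h
    · exact absurd hij (hzlt j i h hi).ne'
  · intro t ht
    obtain ⟨j, hj, rfl⟩ := Finset.mem_image.1 ht
    have hj := Finset.mem_range.1 hj
    have a1 := hz j hj
    have a2 := hy j (by omega)
    have a3 := hy (j + 1) (by omega)
    have a4 : 0 ≤ x j := by rw [← hx0]; exact hxm.monotone (Nat.zero_le _)
    have a5 : x (j + 1 + 1) < 1 := by rw [hxs]; exact nodeL_lt s _ (by omega)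
    exact ⟨⟨by linarith, by linarith⟩, a1.2.2⟩

lemma exists_W (D : Polynomial ℝ) (P : ℝ → ℝ)
    (hD : ∀ t, D.eval t = t * (t ^ 2 - 1) * (P t + 1)) (hP : ∀ t, P (-t) = P t)
    (hP0 : ∀ t, 0 ≤ P t) :
    ∃ W : ℝ → ℝ, (∀ t, HasDerivAt W (D.eval t) t) ∧ (∀ t, W (-t) = W t) ∧
      Filter.Tendsto (fun t => W t / t ^ 2) (Filter.cocompact ℝ) Filter.atTop := by
  let W : ℝ → ℝ := fun t => ∫ x in (0 : ℝ)..t, D.eval x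
  have hW : ∀ t, HasDerivAt W (D.eval t) t := fun t =>
    intervalIntegral.integral_hasDerivAt_right (D.continuous.intervalIntegrable _ _)
      D.continuous.stronglyMeasurable.stronglyMeasurableAtFilter D.continuous.continuousAt
  have hodd : ∀ t, D.eval (-t) = - D.eval t := by
    intro t; rw [hD, hD, hP]; ring
  have heven : ∀ t, W (-t) = W t := by
    intro t
    have h := intervalIntegral.integral_comp_neg (a := (0 : ℝ)) (b := t) (fun x => D.eval x)
    simp only [hodd, neg_zero, intervalIntegral.integral_neg] at h
    simp only [W]
    rw [intervalIntegral.integral_symm, ← h, neg_neg]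
  refine ⟨W, hW, heven, ?_⟩
  have hV : ∀ t, HasDerivAt (fun t => W t - (t ^ 4 / 4 - t ^ 2 / 2))
      (t * (t ^ 2 - 1) * P t) t := by
    intro t
    have h1 := ((hasDerivAt_pow 4 t).div_const 4).fun_sub ((hasDerivAt_pow 2 t).div_const 2)
    refine ((hW t).fun_sub h1).congr_deriv ?_
    rw [hD]; norm_num; ring
  have hmono : MonotoneOn (fun t => W t - (t ^ 4 / 4 - t ^ 2 / 2)) (Set.Ici 1) := by
    refine monotoneOn_of_deriv_nonneg (convex_Ici 1)
      (fun t _ => (hV t).continuousAt.continuousWithinAt)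
      (fun t _ => (hV t).differentiableAt.differentiableWithinAt) ?_
    intro t ht
    rw [interior_Ici] at ht
    have ht : 1 < t := ht
    rw [(hV t).deriv]
    have h1 : 0 ≤ t ^ 2 - 1 := by nlinarith
    have := hP0 t
    positivity
  have hbd : ∀ t : ℝ, 1 ≤ t → t ^ 2 / 4 - 1 / 2 - |W 1 + 1 / 4| ≤ W t / t ^ 2 := by
    intro t ht
    have h := hmono (Set.mem_Ici.2 le_rfl) (Set.mem_Ici.2 ht) ht
    simp only at h
    have ht2 : 1 ≤ t ^ 2 := by nlinarith
    rw [le_div_iff₀ (by positivity)]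
    have h3 : -(|W 1 + 1 / 4| * t ^ 2) ≤ W 1 + 1 / 4 := by
      have := neg_abs_le (W 1 + 1 / 4)
      have := abs_nonneg (W 1 + 1 / 4)
      nlinarith
    nlinarith
  have hTop : Filter.Tendsto (fun t => W t / t ^ 2) Filter.atTop Filter.atTop := by
    refine Filter.tendsto_atTop_mono' _
      ((Filter.eventually_ge_atTop (1 : ℝ)).mono hbd) ?_
    have : Filter.Tendsto (fun t : ℝ => t ^ 2 / 4) Filter.atTop Filter.atTop :=
      (Filter.tendsto_pow_atTop two_ne_zero).atTop_div_const (by norm_num)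
    simp only [sub_eq_add_neg, add_assoc]
    exact Filter.tendsto_atTop_add_const_right _ _ this
  rw [cocompact_eq_atBot_atTop, Filter.tendsto_sup]
  refine ⟨?_, hTop⟩
  have := hTop.comp Filter.tendsto_neg_atBot_atTop
  refine this.congr fun t => ?_
  simp [heven]

lemma ncard_zero_le {n : ℕ} {W : ℝ → ℝ} {D : ℝ → ℝ} (hW : ∀ t, HasDerivAt W (D t) t)
    (hz : ∀ t, D t = 0 → t = 0 ∨ t = 1 ∨ t = -1)
    (hneg : ∀ t, 0 < t → t < 1 → D t < 0)
    {γ : Fin n → Fin n → ℝ} (hγ : ∀ i j, γ i j = γ j i) :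
    {x | IsLocalMin (energy W γ 0) x}.ncard ≤ 2 ^ n := by
  classical
  let f : (Fin n → Bool) → (Fin n → ℝ) := fun σ i => if σ i then 1 else -1
  have hsub : {x | IsLocalMin (energy W γ 0) x} ⊆ Set.range f := by
    intro x hx
    have key : ∀ i, x i = 1 ∨ x i = -1 := by
      intro i
      have h := crit_of_localMin hW hγ 0 x hx i
      simp only [force, mul_zero, zero_mul, add_zero] at h
      rcases hz _ h with h0 | h1
      · exfalso
        have hanti : StrictAntiOn W (Set.Icc 0 1) := by
          refine strictAntiOn_of_deriv_neg (convex_Icc 0 1)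
            (fun t _ => (hW t).continuousAt.continuousWithinAt) ?_
          intro t ht
          rw [interior_Icc] at ht
          rw [(hW t).deriv]
          exact hneg t ht.1 ht.2
        have hc : ContinuousAt (fun t => Function.update x i t) (x i) := by fun_prop
        have hl : IsLocalMin (fun t => energy W γ 0 (Function.update x i t)) (x i) := by
          have h2 : IsLocalMin (energy W γ 0) (Function.update x i (x i)) := by simpa using hx
          exact IsLocalMin.comp_continuous (g := fun t => Function.update x i t) h2 hc
        rw [h0] at hl
        have hl' : ∀ᶠ t in nhdsWithin (0 : ℝ) (Set.Ioi 0),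
          energy W γ 0 (Function.update x i 0) ≤ energy W γ 0 (Function.update x i t) :=
          nhdsWithin_le_nhds hl
        obtain ⟨t, ht1, ht2⟩ := (hl'.and (Ioo_mem_nhdsGT (one_pos : (0 : ℝ) < 1))).exists
        have hlt : W t < W 0 := hanti ⟨le_rfl, zero_le_one⟩ ⟨ht2.1.le, ht2.2.le⟩ ht2.1
        have : energy W γ 0 (Function.update x i t) < energy W γ 0 (Function.update x i 0) := by
          simp only [energy, zero_div, zero_mul, add_zero]
          refine Finset.sum_lt_sum (fun j _ => ?_) ⟨i, Finset.mem_univ _, by simpa using hlt⟩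
          by_cases hj : j = i
          · subst hj; simpa using hlt.le
          · simp [Function.update_of_ne hj]
        linarith
      · exact h1
    refine ⟨fun i => decide (x i = 1), ?_⟩
    funext i
    rcases key i with h | h
    · simp [f, h]
    · have : ¬ ((-1 : ℝ) = 1) := by norm_num
      simp [f, h, this]
  calc _ ≤ (Set.range f).ncard := Set.ncard_le_ncard hsub (Set.finite_range f)
    _ ≤ Nat.card (Fin n → Bool) := by
        rw [← Set.image_univ, ← Set.ncard_univ]
        exact Set.ncard_image_le
    _ = 2 ^ n := by simp

lemma force_diff {n : ℕ} (γ : Fin n → Fin n → ℝ) (A : ℝ) (hA : 0 < A)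
    (hp : ∀ i, ∑ j, max (γ i j) 0 ≤ A) (hm : ∀ i, ∑ j, max (-γ i j) 0 ≤ A)
    (σ x : Fin n → ℝ) (hx : ∀ i, |x i - σ i| ≤ 1 / 8) (i : Fin n) :
    |force γ (1 / (4 * A)) x i - force γ (1 / (4 * A)) σ i| ≤ 1 / 4 := by
  have e : force γ (1 / (4 * A)) x i - force γ (1 / (4 * A)) σ i =
      (2 * (1 / (4 * A))) * ∑ j, γ i j * ((x i - σ i) - (x j - σ j)) := by
    unfold force
    rw [← mul_sub, ← Finset.sum_sub_distrib]
    congr 1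
    exact Finset.sum_congr rfl fun _ _ => by ring
  have h1 : |∑ j, γ i j * ((x i - σ i) - (x j - σ j))| ≤ A / 2 := by
    calc _ ≤ ∑ j, |γ i j * ((x i - σ i) - (x j - σ j))| := Finset.abs_sum_le_sum_abs _ _
      _ ≤ ∑ j, (max (γ i j) 0 + max (-γ i j) 0) * (1 / 4) := by
        refine Finset.sum_le_sum fun j _ => ?_
        rw [abs_mul, max_zero_add_max_neg_zero_eq_abs_self]
        refine mul_le_mul_of_nonneg_left ?_ (abs_nonneg _)
        have a1 := abs_le.1 (hx i)
        have a2 := abs_le.1 (hx j)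
        rw [abs_le]
        constructor <;> linarith [a1.1, a1.2, a2.1, a2.2]
      _ = (∑ j, max (γ i j) 0 + ∑ j, max (-γ i j) 0) * (1 / 4) := by
        rw [← Finset.sum_mul, Finset.sum_add_distrib]
      _ ≤ A / 2 := by linarith [hp i, hm i]
  have hk : 0 < 2 * (1 / (4 * A)) := by positivity
  rw [e, abs_mul, abs_of_pos hk]
  calc _ ≤ 2 * (1 / (4 * A)) * (A / 2) := mul_le_mul_of_nonneg_left h1 hk.le
    _ = 1 / 4 := by field_simp

lemma force_le {n : ℕ} (γ : Fin n → Fin n → ℝ) (A : ℝ) (hA : 0 < A)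
    (hp : ∀ i, ∑ j, max (γ i j) 0 ≤ A) (hm : ∀ i, ∑ j, max (-γ i j) 0 ≤ A)
    (σ : Fin n → ℝ) (hσ : ∀ i, σ i = 1 ∨ σ i = -1) (i : Fin n) :
    |force γ (1 / (4 * A)) σ i| ≤ 1 := by
  have h1 : |∑ j, γ i j * (σ i - σ j)| ≤ 2 * A := by
    have hP : ∀ j, -(2 * max (-γ i j) 0) ≤ γ i j * 2 ∧ γ i j * 2 ≤ 2 * max (γ i j) 0 := by
      intro j
      constructor
      · linarith [le_max_left (-γ i j) 0]
      · linarith [le_max_left (γ i j) 0]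
    have s1 : ∑ j, 2 * max (γ i j) 0 ≤ 2 * A := by rw [← Finset.mul_sum]; linarith [hp i]
    have s2 : ∑ j, 2 * max (-γ i j) 0 ≤ 2 * A := by rw [← Finset.mul_sum]; linarith [hm i]
    rw [abs_le]
    rcases hσ i with hi | hi
    · constructor
      · have : ∑ j, -(2 * max (-γ i j) 0) ≤ ∑ j, γ i j * (σ i - σ j) := by
          refine Finset.sum_le_sum fun j _ => ?_
          rcases hσ j with hj | hj <;> rw [hi, hj]
          · linarith [le_max_right (-γ i j) 0]
          · linarith [(hP j).1]
        rw [Finset.sum_neg_distrib] at this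
        linarith
      · have : ∑ j, γ i j * (σ i - σ j) ≤ ∑ j, (2 * max (γ i j) 0) := by
          refine Finset.sum_le_sum fun j _ => ?_
          rcases hσ j with hj | hj <;> rw [hi, hj]
          · linarith [le_max_right (γ i j) 0]
          · linarith [(hP j).2]
        linarith
    · constructor
      · have : ∑ j, -(2 * max (γ i j) 0) ≤ ∑ j, γ i j * (σ i - σ j) := by
          refine Finset.sum_le_sum fun j _ => ?_
          rcases hσ j with hj | hj <;> rw [hi, hj]
          · linarith [(hP j).2]
          · linarith [le_max_right (γ i j) 0]
        rw [Finset.sum_neg_distrib] at this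
        linarith
      · have : ∑ j, γ i j * (σ i - σ j) ≤ ∑ j, (2 * max (-γ i j) 0) := by
          refine Finset.sum_le_sum fun j _ => ?_
          rcases hσ j with hj | hj <;> rw [hi, hj]
          · linarith [(hP j).1]
          · linarith [le_max_right (-γ i j) 0]
        linarith
  have hk : 0 < 2 * (1 / (4 * A)) := by positivity
  unfold force
  rw [abs_mul, abs_of_pos hk]
  calc _ ≤ 2 * (1 / (4 * A)) * (2 * A) := mul_le_mul_of_nonneg_left h1 hk.le
    _ = 1 := by field_simp; norm_num

/-- sign of a Boolean -/
noncomputable def sgn (b : Bool) : ℝ := if b then 1 else -1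

lemma sgn_cases (b : Bool) : sgn b = 1 ∨ sgn b = -1 := by cases b <;> simp [sgn]

lemma exists_special {n : ℕ} (γ : Fin n → Fin n → ℝ) (hd : ∀ i, γ i i = 0)
    (hne : ∃ i j : Fin n, i ≠ j ∧ γ i j ≠ 0) :
    ∃ (A : ℝ) (i₀ : Fin n) (τ : Fin n → Bool) (c : ℝ), 0 < A ∧
      (∀ i, ∑ j, max (γ i j) 0 ≤ A) ∧ (∀ i, ∑ j, max (-γ i j) 0 ≤ A) ∧
      (c = 1 ∨ c = -1) ∧ τ i₀ = true ∧
      force γ (1 / (4 * A)) (fun i => sgn (τ i)) i₀ = c := by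
  classical
  obtain ⟨p, q, -, hpq⟩ := hne
  obtain ⟨⟨i₀, b⟩, -, hmax⟩ := Finset.exists_max_image (Finset.univ : Finset (Fin n × Bool))
    (fun y => ∑ j, max (sgn y.2 * γ y.1 j) 0) ⟨(p, true), Finset.mem_univ _⟩
  simp only [Finset.mem_univ, forall_true_left] at hmax
  have hp : ∀ i, ∑ j, max (γ i j) 0 ≤ ∑ j, max (sgn b * γ i₀ j) 0 := by
    intro i; simpa [sgn] using hmax (i, true)
  have hm : ∀ i, ∑ j, max (-γ i j) 0 ≤ ∑ j, max (sgn b * γ i₀ j) 0 := by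
    intro i; simpa [sgn] using hmax (i, false)
  set A := ∑ j, max (sgn b * γ i₀ j) 0 with hAdef
  have hA : 0 < A := by
    rcases lt_or_gt_of_ne hpq with h | h
    · have : max (-γ p q) 0 ≤ ∑ j, max (-γ p j) 0 :=
        Finset.single_le_sum (f := fun j => max (-γ p j) 0) (fun j _ => le_max_right _ _)
          (Finset.mem_univ q)
      have h2 := le_max_left (-γ p q) 0
      linarith [hm p]
    · have : max (γ p q) 0 ≤ ∑ j, max (γ p j) 0 :=
        Finset.single_le_sum (f := fun j => max (γ p j) 0) (fun j _ => le_max_right _ _)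
          (Finset.mem_univ q)
      have h2 := le_max_left (γ p q) 0
      linarith [hp p]
  have hcc : sgn b * sgn b = 1 := by cases b <;> simp [sgn]
  refine ⟨A, i₀, fun j => decide (sgn b * γ i₀ j ≤ 0), sgn b, hA, hp, hm, sgn_cases b,
    by simp [hd], ?_⟩
  unfold force
  have e : ∑ j, γ i₀ j * (sgn (decide (sgn b * γ i₀ i₀ ≤ 0)) - sgn (decide (sgn b * γ i₀ j ≤ 0)))
      = 2 * sgn b * A := by
    rw [hAdef, Finset.mul_sum]
    refine Finset.sum_congr rfl fun j _ => ?_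
    rw [hd i₀]
    by_cases h : sgn b * γ i₀ j ≤ 0
    · rw [max_eq_right h, decide_eq_true h]
      have e1 : sgn (decide (sgn b * 0 ≤ 0)) = 1 := by simp [sgn]
      rw [e1]; simp [sgn]
    · rw [max_eq_left (le_of_not_ge h)]
      have : 2 * sgn b * (sgn b * γ i₀ j) = 2 * γ i₀ j := by
        rw [show 2 * sgn b * (sgn b * γ i₀ j) = 2 * (sgn b * sgn b) * γ i₀ j by ring, hcc]; ring
      rw [this]
      have e1 : sgn (decide (sgn b * 0 ≤ 0)) = 1 := by simp [sgn]
      have e2 : sgn (decide (sgn b * γ i₀ j ≤ 0)) = -1 := by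
        rw [decide_eq_false h]; simp [sgn]
      rw [e1, e2]; ring
  simp only
  rw [e]
  field_simp
  norm_num

lemma lower {n : ℕ} (s : ℕ) {W D : ℝ → ℝ} (hW : ∀ t, HasDerivAt W (D t) t)
    (hodd : ∀ t, D (-t) = - D t)
    {γ : Fin n → Fin n → ℝ} (hγ : ∀ i j, γ i j = γ j i) (hd : ∀ i, γ i i = 0)
    (hne : ∃ i j : Fin n, i ≠ j ∧ γ i j ≠ 0)
    (hfin : ∀ κ, {x | IsLocalMin (energy W γ κ) x}.Finite)
    (h7 : D (7 / 8) < -(5 / 4)) (h9 : 5 / 4 < D (9 / 8))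
    (hivl : ∀ c : ℝ, c = 1 ∨ c = -1 → ∃ a b : ℕ → ℝ,
      (∀ k ≤ s, 7 / 8 ≤ a k ∧ a k < b k ∧ b k ≤ 9 / 8 ∧ D (a k) < -c - 1 / 4 ∧
        -c + 1 / 4 < D (b k)) ∧
      ∀ k ≤ s, ∀ k' ≤ s, ∀ t, a k < t → t < b k → a k' < t → t < b k' → k = k') :
    ∃ κ : ℝ, 0 < κ ∧ 2 ^ n + 2 * s ≤ {x | IsLocalMin (energy W γ κ) x}.ncard := by
  classical
  obtain ⟨A, i₀, τ, c, hA, hp, hm, hc, hτ, hF⟩ := exists_special γ hd hne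
  obtain ⟨a, b, hab, hdisj⟩ := hivl c hc
  refine ⟨1 / (4 * A), by positivity, ?_⟩
  let nτ : Fin n → Bool := fun i => !(τ i)
  let spec : (Fin n → Bool) → Prop := fun σ => σ = τ ∨ σ = nτ
  have hspecF : ∀ σ, spec σ →
      force γ (1 / (4 * A)) (fun i => sgn (σ i)) i₀ = sgn (σ i₀) * c := by
    rintro σ (rfl | rfl)
    · rw [hF, hτ]; simp [sgn]
    · have : ∀ i, sgn (nτ i) = - sgn (τ i) := by
        intro i; simp only [nτ]; cases τ i <;> simp [sgn]
      rw [this, hτ, ← hF]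
      simp only [force, this]
      simp only [sgn, if_true]
      rw [show ∀ u v : ℝ, -1 * (u * v) = u * (-v) by intros; ring, ← Finset.sum_neg_distrib]
      congr 1
      exact Finset.sum_congr rfl fun _ _ => by ring
  let α : (Fin n → Bool) → ℕ → Fin n → ℝ := fun σ k i => if i = i₀ ∧ spec σ then a k else 7 / 8
  let β : (Fin n → Bool) → ℕ → Fin n → ℝ := fun σ k i => if i = i₀ ∧ spec σ then b k else 9 / 8
  have hαβ : ∀ σ, ∀ k ≤ s, ∀ i, 7 / 8 ≤ α σ k i ∧ α σ k i < β σ k i ∧ β σ k i ≤ 9 / 8 := by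
    intro σ k hk i
    have := hab k hk
    simp only [α, β]
    split_ifs
    · exact ⟨this.1, this.2.1, this.2.2.1⟩
    · norm_num
  have hbox : ∀ (σ : Fin n → Bool) (k : ℕ), ∃ x, k ≤ s →
      (IsLocalMin (energy W γ (1 / (4 * A))) x ∧
        ∀ i, α σ k i < sgn (σ i) * x i ∧ sgn (σ i) * x i < β σ k i) := by
    intro σ k
    by_cases hk : k ≤ s
    swap
    · exact ⟨0, fun h => absurd h hk⟩
    have hab' := hαβ σ k hk
    let lo : Fin n → ℝ := fun i => if σ i then α σ k i else -β σ k i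
    let hi : Fin n → ℝ := fun i => if σ i then β σ k i else -α σ k i
    have hnear : ∀ x ∈ Set.Icc lo hi, ∀ i, |x i - sgn (σ i)| ≤ 1 / 8 := by
      intro x hx i
      have h1 := hx.1 i
      have h2 := hx.2 i
      have h3 := hab' i
      simp only [lo, hi] at h1 h2
      rw [abs_le]
      cases hσ : σ i <;> simp [hσ] at h1 h2 <;> simp [sgn] <;> constructor <;> linarith
    have hD : ∀ x ∈ Set.Icc lo hi, ∀ i, D (α σ k i) + sgn (σ i) * force γ (1 / (4 * A)) x i < 0 ∧
        0 < D (β σ k i) + sgn (σ i) * force γ (1 / (4 * A)) x i := by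
      intro x hx i
      have g1 := force_diff γ A hA hp hm (fun i => sgn (σ i)) x (hnear x hx) i
      have g2 := force_le γ A hA hp hm (fun i => sgn (σ i)) (fun i => sgn_cases _) i
      rw [abs_le] at g1 g2
      by_cases hsp : i = i₀ ∧ spec σ
      · have e1 : α σ k i = a k := by simp only [α]; rw [if_pos hsp]
        have e2 : β σ k i = b k := by simp only [β]; rw [if_pos hsp]
        have g3 := hspecF σ hsp.2
        have g4 := hab k hk
        rw [e1, e2]
        rw [hsp.1] at g1 ⊢
        rw [g3] at g1
        rcases sgn_cases (σ i₀) with h | h <;> rw [h] at g1 ⊢ <;> constructor <;>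
          linarith [g4.2.2.2.1, g4.2.2.2.2, g1.1, g1.2]
      · have e1 : α σ k i = 7 / 8 := by simp only [α]; rw [if_neg hsp]
        have e2 : β σ k i = 9 / 8 := by simp only [β]; rw [if_neg hsp]
        rw [e1, e2]
        rcases sgn_cases (σ i) with h | h <;> rw [h] <;> constructor <;>
          linarith [g1.1, g1.2, g2.1, g2.2]
    obtain ⟨x, hx1, hx2⟩ := box_lemma hW hγ (1 / (4 * A)) lo hi
      (by
        intro i
        have := (hab' i).2.1
        simp only [lo, hi]
        split_ifs <;> linarith)
      (by
        intro x hx i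
        have := hD x hx i
        simp only [lo]
        cases hσ : σ i <;> simp [hσ, sgn] at this ⊢
        · rw [hodd]; linarith
        · exact this.1)
      (by
        intro x hx i
        have := hD x hx i
        simp only [hi]
        cases hσ : σ i <;> simp [hσ, sgn] at this ⊢
        · rw [hodd]; linarith
        · exact this.2)
    refine ⟨x, fun _ => ⟨hx1, fun i => ?_⟩⟩
    have := hx2 i
    simp only [lo, hi] at this
    cases hσ : σ i <;> simp [hσ, sgn] at this ⊢
    · constructor <;> linarith
    · exact this
  choose X hX using hbox
  let J₁ : Finset ((Fin n → Bool) × ℕ) := Finset.univ ×ˢ {0}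
  let J₂ : Finset ((Fin n → Bool) × ℕ) := {τ, nτ} ×ˢ Finset.Ioc 0 s
  have hJ1 : ∀ p ∈ J₁, p.2 ≤ s := by
    intro p hp
    have : p.2 = 0 := Finset.mem_singleton.1 (Finset.mem_product.1 hp).2
    omega
  have hJ2 : ∀ p ∈ J₂, p.2 ≤ s ∧ 0 < p.2 ∧ spec p.1 := by
    intro p hp; simp [J₂] at hp; exact ⟨hp.2.2, hp.2.1, hp.1⟩
  have hJs : ∀ p ∈ J₁ ∪ J₂, p.2 ≤ s := by
    intro p hp
    rcases Finset.mem_union.1 hp with h | h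
    · exact hJ1 p h
    · exact (hJ2 p h).1
  have hcard : (J₁ ∪ J₂).card = 2 ^ n + 2 * s := by
    rw [Finset.card_union_of_disjoint]
    · have hne' : τ ≠ nτ := by
        intro h
        have := congrFun h i₀
        simp [nτ] at this
      simp only [J₁, J₂, Finset.card_product, Finset.card_pair hne']
      simp
    · rw [Finset.disjoint_left]
      intro p hp hp'
      have := (hJ2 p hp').2.1
      have : p.2 = 0 := Finset.mem_singleton.1 (Finset.mem_product.1 hp).2
      omega
  have hinj : Set.InjOn (fun p : (Fin n → Bool) × ℕ => X p.1 p.2)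
      ((J₁ ∪ J₂ : Finset _) : Set ((Fin n → Bool) × ℕ)) := by
    rintro ⟨σ, k⟩ hp ⟨σ', k'⟩ hp' heq
    simp only at heq
    have hp := Finset.mem_coe.1 hp
    have hp' := Finset.mem_coe.1 hp'
    have q1 := (hX σ k (hJs _ hp)).2
    have q2 := (hX σ' k' (hJs _ hp')).2
    rw [← heq] at q2
    have hσ : σ = σ' := by
      funext i
      have r1 := q1 i
      have r2 := q2 i
      have r3 := hαβ σ k (hJs _ hp) i
      have r4 := hαβ σ' k' (hJs _ hp') i
      cases h1 : σ i <;> cases h2 : σ' i <;> simp only [h1, h2, sgn] at r1 r2 ⊢ <;> exfalso <;>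
        simp at r1 r2 <;> linarith
    subst hσ
    have hk : k = k' := by
      by_cases hsp : spec σ
      · have r1 := q1 i₀
        have r2 := q2 i₀
        simp only [α, β, hsp, and_self, if_true] at r1 r2
        exact hdisj k (hJs _ hp) k' (hJs _ hp') _ r1.1 r1.2 r2.1 r2.2
      · have z : ∀ l, (σ, l) ∈ J₁ ∪ J₂ → l = 0 := by
          intro l hl
          rcases Finset.mem_union.1 hl with h | h
          · exact Finset.mem_singleton.1 (Finset.mem_product.1 h).2
          · exact absurd (hJ2 _ h).2.2 hsp
        rw [z k hp, z k' hp']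
    rw [hk]
  rw [← hcard, ← Set.ncard_coe_finset, ← hinj.ncard_image]
  refine Set.ncard_le_ncard ?_ (hfin _)
  rintro _ ⟨⟨σ, k⟩, hp, rfl⟩
  exact (hX σ k (hJs _ (Finset.mem_coe.1 hp))).1

/-- for every `s ≥ 0` there is a potential `W ∈ 𝒲` (with `2s+1`
inflection points in `(0, m)`) such that for every connected weighted graph with
`‖L(G)‖ > 0` there exists `κ > 0` with `m(W,G,κ) ≥ m(W,G,0) + 2s`, where
`m(W,G,κ)` counts the local minima of `E_{W,G,κ}`; hence `C(W) ≥ 2s`. -/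
theorem stmt12 (s : ℕ) :
    ∃ (m : ℝ) (W : ℝ → ℝ),
      0 < m ∧ ContDiff ℝ 2 W ∧ (∀ t, W (-t) = W t) ∧
      deriv W m = 0 ∧ deriv W (-m) = 0 ∧
      (∀ t, t ∈ Set.Ioo (-m) 0 ∪ Set.Ioi m → 0 < deriv W t) ∧
      (∀ t, t ∈ Set.Iio (-m) ∪ Set.Ioo 0 m → deriv W t < 0) ∧
      Filter.Tendsto (fun t => W t / t ^ 2) (Filter.cocompact ℝ) Filter.atTop ∧
      (∃ I : Finset ℝ, I.card = 2 * s + 1 ∧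
        ∀ t ∈ I, t ∈ Set.Ioo 0 m ∧ deriv (deriv W) t = 0) ∧
      (∀ (n : ℕ) (γ : Fin n → Fin n → ℝ),
        (∀ i j, γ i j = γ j i) → (∀ i, γ i i = 0) →
        (∀ i j : Fin n, Relation.ReflTransGen (fun a b => γ a b ≠ 0) i j) →
        (∃ i j : Fin n, i ≠ j ∧ γ i j ≠ 0) →
        ∃ κ : ℝ, 0 < κ ∧
          {x : Fin n → ℝ | IsLocalMin
              (fun y => ∑ i, W (y i) + (0 : ℝ) / 2 * ∑ i, ∑ j, γ i j * (y i - y j) ^ 2) x}.ncard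
            + 2 * s ≤
          {x : Fin n → ℝ | IsLocalMin
              (fun y => ∑ i, W (y i) + κ / 2 * ∑ i, ∑ j, γ i j * (y i - y j) ^ 2) x}.ncard) := by
  obtain ⟨D, P, hdeg, hD, hP, hP0, hnode⟩ := exists_D s
  obtain ⟨W, hW, heven, htop⟩ := exists_W D P hD hP hP0
  have hderiv : deriv W = fun t => D.eval t := funext fun t => (hW t).deriv
  have hodd : ∀ t, D.eval (-t) = - D.eval t := by
    intro t; rw [hD, hD, hP]; ring
  have hneg : ∀ t, 0 < t → t < 1 → D.eval t < 0 := by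
    intro t h0 h1
    rw [hD]
    have : 0 < P t + 1 := by linarith [hP0 t]
    have h2 : t * (t ^ 2 - 1) < 0 := mul_neg_of_pos_of_neg h0 (by nlinarith)
    exact mul_neg_of_neg_of_pos h2 this
  have hpos : ∀ t, 1 < t → 0 < D.eval t := by
    intro t h1
    rw [hD]
    have : 0 < P t + 1 := by linarith [hP0 t]
    have h2 : 0 < t * (t ^ 2 - 1) := mul_pos (by linarith) (by nlinarith)
    exact mul_pos h2 this
  have hzero : ∀ t, D.eval t = 0 → t = 0 ∨ t = 1 ∨ t = -1 := by
    intro t h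
    rw [hD] at h
    have : P t + 1 ≠ 0 := by linarith [hP0 t]
    rcases mul_eq_zero.1 h with h | h
    · rcases mul_eq_zero.1 h with h | h
      · exact Or.inl h
      · right
        have h' : (t - 1) * (t + 1) = 0 := by linarith
        rcases mul_eq_zero.1 h' with h | h
        · left; linarith
        · right; linarith
    · exact absurd h this
  have h1 : D.eval 1 = 0 := by rw [hD]; ring
  have hn0 := hnode 0 (by omega)
  rw [nodeL_zero] at hn0
  have hw0 : nodeW 0 = -2 := by simp [nodeW]
  have hivl : ∀ c : ℝ, c = 1 ∨ c = -1 → ∃ a b : ℕ → ℝ,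
      (∀ k ≤ s, 7 / 8 ≤ a k ∧ a k < b k ∧ b k ≤ 9 / 8 ∧ D.eval (a k) < -c - 1 / 4 ∧
        -c + 1 / 4 < D.eval (b k)) ∧
      ∀ k ≤ s, ∀ k' ≤ s, ∀ t, a k < t → t < b k → a k' < t → t < b k' → k = k' := by
    have hwe : ∀ k, nodeW (2 * k) = -2 := by intro k; simp [nodeW]
    have hwo : ∀ k, nodeW (2 * k + 1) = -1 / 2 := by intro k; simp [nodeW]
    have hdj : ∀ k k' t, nodeL s (2 * k) < t → t < nodeL s (2 * k + 1) →
        nodeL s (2 * k') < t → t < nodeL s (2 * k' + 1) → k = k' := by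
      intro k k' t a1 a2 a3 a4
      have b1 : 2 * k < 2 * k' + 1 := (nodeL_strictMono s).lt_iff_lt.1 (a1.trans a4)
      have b2 : 2 * k' < 2 * k + 1 := (nodeL_strictMono s).lt_iff_lt.1 (a3.trans a2)
      omega
    rintro c (rfl | rfl)
    · refine ⟨fun k => nodeL s (2 * k), fun k => nodeL s (2 * k + 1), ?_, ?_⟩
      · intro k hk
        have b1 := nodeL_lt s (2 * k + 1) (by omega)
        have b2 := (hnode (2 * k) (by omega)).1
        have b3 := (hnode (2 * k + 1) (by omega)).1
        refine ⟨nodeL_ge _ _, nodeL_strictMono s (by omega), by linarith, ?_, ?_⟩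
        · simp only [b2, hwe]; norm_num
        · simp only [b3, hwo]; norm_num
      · intro k _ k' _ t
        exact hdj k k' t
    · refine ⟨fun k => 2 - nodeL s (2 * k + 1), fun k => 2 - nodeL s (2 * k), ?_, ?_⟩
      · intro k hk
        have b0 := nodeL_lt s (2 * k + 1) (by omega)
        have b1 := nodeL_ge s (2 * k)
        have b2 := (hnode (2 * k) (by omega)).2
        have b3 := (hnode (2 * k + 1) (by omega)).2
        have b4 : nodeL s (2 * k) < nodeL s (2 * k + 1) := nodeL_strictMono s (by omega)
        refine ⟨by linarith, by linarith, by linarith, ?_, ?_⟩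
        · simp only [b3, hwo]; norm_num
        · simp only [b2, hwe]; norm_num
      · intro k _ k' _ t a1 a2 a3 a4
        exact hdj k k' (2 - t) (by linarith) (by linarith) (by linarith) (by linarith)
  refine ⟨1, W, one_pos, ?_, heven, ?_, ?_, ?_, ?_, htop, ?_, ?_⟩
  · have h2 : ContDiff ℝ (1 + 1) W := by
      rw [contDiff_succ_iff_deriv]
      refine ⟨fun t => (hW t).differentiableAt, by simp, ?_⟩
      rw [hderiv]
      simpa using D.contDiff_aeval (𝕜 := ℝ) 1
    exact h2
  · rw [hderiv]; exact h1
  · rw [hderiv]; simp only [hodd, h1, neg_zero]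
  · rintro t (ht | ht)
    · have h := hneg (-t) (by linarith [ht.2]) (by linarith [ht.1])
      rw [hodd] at h
      rw [hderiv]; simp only; linarith
    · rw [hderiv]; exact hpos t ht
  · rintro t (ht | ht)
    · have ht : t < -1 := ht
      have h := hpos (-t) (by linarith)
      rw [hodd] at h
      rw [hderiv]; simp only; linarith
    · rw [hderiv]; exact hneg t ht.1 ht.2
  · rw [hderiv]
    exact inflections s D (by rw [hD]; ring) fun j hj => (hnode j hj).1
  · intro n γ hγ hd _ hne
    obtain ⟨κ, hκ, hle⟩ := lower (n := n) s hW hodd hγ hd hne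
      (fun κ => finite_localMin D hdeg hW hγ κ)
      (by rw [hn0.1, hw0]; norm_num)
      (by rw [show (9 / 8 : ℝ) = 2 - 7 / 8 by norm_num, hn0.2, hw0]; norm_num) hivl
    refine ⟨κ, hκ, ?_⟩
    have hup := ncard_zero_le (n := n) hW hzero hneg hγ
    exact (Nat.add_le_add_right hup (2 * s)).trans hle
end
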